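/- arXiv:2003.02967 — 6 statements merged into one kernel-verified Lean document; each statement's English description precedes it below -/
import Mathlib

section
/- For every integer n ≥ 1, the sum over all perfect matchings M of the vertex set {1,…,2n} of the complete graph K_{2n} of (−1)^{cr(M)} equals 1, where cr(M) is the number of crossing pairs of chords of M. -/
/-- Two chords `p = (a,b)` and `q = (c,d)` (each stored with first coordinate smaller)
cross if `a < c < b < d` or `c < a < d < b`. -/
def chordCross {n : ℕ} (p q : Fin (2 * n) × Fin (2 * n)) : Prop :=
  (p.1 < q.1 ∧ q.1 < p.2 ∧ p.2 < q.2) ∨ (q.1 < p.1 ∧ p.1 < q.2 ∧ q.2 < p.2)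

instance {n : ℕ} (p q : Fin (2 * n) × Fin (2 * n)) : Decidable (chordCross p q) := by
  unfold chordCross; infer_instance

/-- `cr M` is the number of unordered pairs of chords of `M` that cross.  Since distinct
chords of a matching are vertex-disjoint, requiring `z.1.1 < z.2.1` counts each unordered
crossing pair exactly once. -/
def cr {n : ℕ} (M : Finset (Fin (2 * n) × Fin (2 * n))) : ℕ :=
  ((M ×ˢ M).filter (fun z => z.1.1 < z.2.1 ∧ chordCross z.1 z.2)).card

/-- A perfect matching of `{1,…,2n}` encoded as a finite set of ordered pairs: each pair is
increasing, and every vertex lies in exactly one pair. -/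
def IsPerfectMatching' {n : ℕ} (M : Finset (Fin (2 * n) × Fin (2 * n))) : Prop :=
  (∀ p ∈ M, p.1 < p.2) ∧
    ∀ v : Fin (2 * n), (M.filter (fun p => p.1 = v ∨ p.2 = v)).card = 1

instance {n : ℕ} : DecidablePred (IsPerfectMatching' (n := n)) := fun M => by
  unfold IsPerfectMatching'; infer_instance

/-- The image of a set of chords under a relabelling of the vertices. -/
def relabel {n : ℕ} (s : Equiv.Perm (Fin (2 * n))) (M : Finset (Fin (2 * n) × Fin (2 * n))) :
    Finset (Fin (2 * n) × Fin (2 * n)) :=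
  M.map (s.prodCongr s).toEmbedding

lemma mem_relabel_swap {n : ℕ} {a b : Fin (2 * n)} {M : Finset (Fin (2 * n) × Fin (2 * n))}
    {p : Fin (2 * n) × Fin (2 * n)} :
    p ∈ relabel (Equiv.swap a b) M ↔ (Equiv.swap a b p.1, Equiv.swap a b p.2) ∈ M := by
  rw [relabel, Finset.mem_map_equiv]
  rfl

lemma relabel_swap_relabel_swap {n : ℕ} (a b : Fin (2 * n))
    (M : Finset (Fin (2 * n) × Fin (2 * n))) :
    relabel (Equiv.swap a b) (relabel (Equiv.swap a b) M) = M := by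
  ext p
  simp [mem_relabel_swap]

namespace IsPerfectMatching'

variable {n : ℕ} {M : Finset (Fin (2 * n) × Fin (2 * n))}

lemma exists_mem (hM : IsPerfectMatching' M) (v : Fin (2 * n)) :
    ∃ p ∈ M, p.1 = v ∨ p.2 = v := by
  obtain ⟨p, hp⟩ := Finset.card_pos.1 ((hM.2 v).symm ▸ Nat.one_pos)
  exact ⟨p, Finset.mem_filter.1 hp⟩

lemma eq_of_mem (hM : IsPerfectMatching' M) {p q : Fin (2 * n) × Fin (2 * n)}
    (hp : p ∈ M) (hq : q ∈ M) (v : Fin (2 * n)) (hpv : p.1 = v ∨ p.2 = v)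
    (hqv : q.1 = v ∨ q.2 = v) : p = q :=
  Finset.card_le_one.1 (hM.2 v).le p (Finset.mem_filter.2 ⟨hp, hpv⟩) q
    (Finset.mem_filter.2 ⟨hq, hqv⟩)

lemma relabel_swap (hM : IsPerfectMatching' M) {a b : Fin (2 * n)} (hab : b.val = a.val + 1)
    (h : (a, b) ∉ M) : IsPerfectMatching' (relabel (Equiv.swap a b) M) := by
  refine ⟨fun p hp => ?_, fun v => ?_⟩
  · rw [mem_relabel_swap] at hp
    have hlt := hM.1 _ hp
    have hne : (Equiv.swap a b p.1, Equiv.swap a b p.2) ≠ (a, b) := fun h' => h (h' ▸ hp)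
    simp only [Equiv.swap_apply_def, ne_eq, Prod.mk.injEq] at hlt hne
    grind
  · rw [relabel, Finset.filter_map, Finset.card_map, ← hM.2 (Equiv.swap a b v)]
    congr 1
    ext p
    simp only [Finset.mem_filter, Function.comp_apply, Equiv.coe_toEmbedding,
      Equiv.prodCongr_apply, Prod.map_fst, Prod.map_snd, Equiv.swap_apply_eq_iff]

end IsPerfectMatching'

lemma cr_eq_card_filter {n : ℕ} (M : Finset (Fin (2 * n) × Fin (2 * n))) :
    cr M = ((M ×ˢ M).filter
      (fun z => z.1.1 < z.2.1 ∧ z.2.1 < z.1.2 ∧ z.1.2 < z.2.2)).card := by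
  unfold cr chordCross
  congr 1
  ext z
  simp only [Finset.mem_filter]
  grind

lemma cr_relabel {n : ℕ} (s : Equiv.Perm (Fin (2 * n)))
    (M : Finset (Fin (2 * n) × Fin (2 * n))) :
    cr (relabel s M) = ((M ×ˢ M).filter
      (fun z => s z.1.1 < s z.2.1 ∧ s z.2.1 < s z.1.2 ∧ s z.1.2 < s z.2.2)).card := by
  rw [cr_eq_card_filter, relabel, ← Finset.prodMap_map_product, Finset.filter_map,
    Finset.card_map]
  rfl

lemma swap_cross_iff {n : ℕ} {M : Finset (Fin (2 * n) × Fin (2 * n))}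
    (hM : IsPerfectMatching' M) {a b : Fin (2 * n)} (hab : b.val = a.val + 1)
    {P Q p q : Fin (2 * n) × Fin (2 * n)}
    (hP : P ∈ M) (hPa : P.1 = a ∨ P.2 = a) (hQ : Q ∈ M) (hQb : Q.1 = b ∨ Q.2 = b)
    (hp : p ∈ M) (hq : q ∈ M) (hPQ : ¬(p = P ∧ q = Q)) (hQP : ¬(p = Q ∧ q = P)) :
    (Equiv.swap a b p.1 < Equiv.swap a b q.1 ∧ Equiv.swap a b q.1 < Equiv.swap a b p.2 ∧
      Equiv.swap a b p.2 < Equiv.swap a b q.2) ↔ (p.1 < q.1 ∧ q.1 < p.2 ∧ p.2 < q.2) := by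
  have h1 := fun h => hM.eq_of_mem hp hP a h hPa
  have h2 := fun h => hM.eq_of_mem hq hP a h hPa
  have h3 := fun h => hM.eq_of_mem hp hQ b h hQb
  have h4 := fun h => hM.eq_of_mem hq hQ b h hQb
  rcases eq_or_ne p q with rfl | hpq
  · simp
  have key : ∀ x y : Fin (2 * n), ¬(x = a ∧ y = b) → ¬(x = b ∧ y = a) →
      (Equiv.swap a b x < Equiv.swap a b y ↔ x < y) := by
    intro x y hx hy
    clear h1 h2 h3 h4 hPa hQb hPQ hQP
    simp only [Equiv.swap_apply_def]
    grind
  rw [key, key, key] <;> grind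

lemma card_eq_card_add_one_of_mem_iff {α : Type*} [DecidableEq α] {T T' : Finset α} {u v : α}
    (h : ∀ z, z ≠ u → z ≠ v → (z ∈ T' ↔ z ∈ T)) (hu : u ∈ T) (hu' : u ∉ T') (hv : v ∉ T)
    (hv' : v ∉ T') : T.card = T'.card + 1 := by
  rw [← Finset.card_insert_of_notMem hu']
  congr 1
  ext z
  rw [Finset.mem_insert]
  rcases eq_or_ne z u with rfl | hzu
  · simp [hu]
  rcases eq_or_ne z v with rfl | hzv
  · simp [hv, hv', hzu]
  simp [hzu, h z hzu hzv]

/-- Exchanging two consecutive vertices that are not joined by a chord creates or destroys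
exactly one crossing. -/
lemma neg_one_pow_cr_relabel_swap {n : ℕ} {M : Finset (Fin (2 * n) × Fin (2 * n))}
    (hM : IsPerfectMatching' M) {a b : Fin (2 * n)} (hab : b.val = a.val + 1)
    (h : (a, b) ∉ M) : (-1 : ℤ) ^ cr M + (-1) ^ cr (relabel (Equiv.swap a b) M) = 0 := by
  obtain ⟨P, hP, hPa⟩ := hM.exists_mem a
  obtain ⟨Q, hQ, hQb⟩ := hM.exists_mem b
  rw [cr_relabel, cr_eq_card_filter]
  set T := (M ×ˢ M).filter (fun z => z.1.1 < z.2.1 ∧ z.2.1 < z.1.2 ∧ z.1.2 < z.2.2) with hT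
  set T' := (M ×ˢ M).filter (fun z => Equiv.swap a b z.1.1 < Equiv.swap a b z.2.1 ∧
    Equiv.swap a b z.2.1 < Equiv.swap a b z.1.2 ∧
    Equiv.swap a b z.1.2 < Equiv.swap a b z.2.2) with hT'
  have hiff : ∀ z, z ≠ (P, Q) → z ≠ (Q, P) → (z ∈ T' ↔ z ∈ T) := by
    rintro ⟨p, q⟩ hPQ hQP
    simp only [hT, hT', Finset.mem_filter, Finset.mem_product]
    refine and_congr_right fun hpq => swap_cross_iff hM hab hP hPa hQ hQb hpq.1 hpq.2 ?_ ?_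
    · rintro ⟨rfl, rfl⟩; exact hPQ rfl
    · rintro ⟨rfl, rfl⟩; exact hQP rfl
  have hPlt := hM.1 P hP
  have hQlt := hM.1 Q hQ
  have hne : P ≠ Q := by
    rintro rfl
    apply h
    have : P = (a, b) := by ext <;> grind
    exact this ▸ hP
  have hdisj : P.1 ≠ Q.1 ∧ P.1 ≠ Q.2 ∧ P.2 ≠ Q.1 ∧ P.2 ≠ Q.2 := by
    have := fun v hv hv' => hne (hM.eq_of_mem hP hQ v hv hv')
    grind
  have hcases : ((P, Q) ∈ T ∧ (Q, P) ∉ T ∧ (P, Q) ∉ T' ∧ (Q, P) ∉ T') ∨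
      ((P, Q) ∉ T ∧ (Q, P) ∈ T ∧ (P, Q) ∉ T' ∧ (Q, P) ∉ T') ∨
      ((P, Q) ∉ T ∧ (Q, P) ∉ T ∧ (P, Q) ∈ T' ∧ (Q, P) ∉ T') ∨
      ((P, Q) ∉ T ∧ (Q, P) ∉ T ∧ (P, Q) ∉ T' ∧ (Q, P) ∈ T') := by
    have hfix : ∀ v, v ≠ a → v ≠ b → Equiv.swap a b v = v :=
      fun v => Equiv.swap_apply_of_ne_of_ne
    have hsa := Equiv.swap_apply_left a b
    have hsb := Equiv.swap_apply_right a b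
    simp only [hT, hT', Finset.mem_filter, Finset.mem_product, hP, hQ, true_and]
    clear hiff hT hT' T T' hM hP hQ h hne
    obtain ⟨p, p'⟩ := P
    obtain ⟨q, q'⟩ := Q
    dsimp only at *
    rcases hPa with rfl | rfl <;> rcases hQb with rfl | rfl
    · rw [hsa, hsb, hfix p' (by grind) (by grind), hfix q' (by grind) (by grind)]
      simp only [Fin.lt_def, Fin.ext_iff] at *
      omega
    · rw [hsa, hsb, hfix p' (by grind) (by grind), hfix q (by grind) (by grind)]
      simp only [Fin.lt_def, Fin.ext_iff] at *
      omega
    · rw [hsa, hsb, hfix p (by grind) (by grind), hfix q' (by grind) (by grind)]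
      simp only [Fin.lt_def, Fin.ext_iff] at *
      omega
    · rw [hsa, hsb, hfix p (by grind) (by grind), hfix q (by grind) (by grind)]
      simp only [Fin.lt_def, Fin.ext_iff] at *
      omega
  have hcard : T.card = T'.card + 1 ∨ T'.card = T.card + 1 := by
    rcases hcases with ⟨h1, h2, h3, h4⟩ | ⟨h1, h2, h3, h4⟩ | ⟨h1, h2, h3, h4⟩ | ⟨h1, h2, h3, h4⟩
    · exact .inl (card_eq_card_add_one_of_mem_iff hiff h1 h3 h2 h4)
    · exact .inl (card_eq_card_add_one_of_mem_iff (fun z h₁ h₂ => hiff z h₂ h₁) h2 h4 h1 h3)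
    · exact .inr (card_eq_card_add_one_of_mem_iff (fun z h₁ h₂ => (hiff z h₁ h₂).symm)
        h3 h1 h4 h2)
    · exact .inr (card_eq_card_add_one_of_mem_iff (fun z h₁ h₂ => (hiff z h₂ h₁).symm)
        h4 h2 h3 h1)
  rcases hcard with hc | hc <;> rw [hc] <;> ring

/-- The perfect matchings whose first `k` chords are `{0,1}, {2,3}, …, {2k-2,2k-1}`. -/
def matchingsWithPrefix (n k : ℕ) : Finset (Finset (Fin (2 * n) × Fin (2 * n))) :=
  Finset.univ.filter fun M => IsPerfectMatching' M ∧
    ∀ j < k, ∀ p : Fin (2 * n) × Fin (2 * n), p.1.val = 2 * j → p.2.val = 2 * j + 1 → p ∈ M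

lemma mem_matchingsWithPrefix {n k : ℕ} {M : Finset (Fin (2 * n) × Fin (2 * n))} :
    M ∈ matchingsWithPrefix n k ↔ IsPerfectMatching' M ∧
      ∀ j < k, ∀ p : Fin (2 * n) × Fin (2 * n),
        p.1.val = 2 * j → p.2.val = 2 * j + 1 → p ∈ M := by
  simp [matchingsWithPrefix]

lemma sum_matchingsWithPrefix_succ {n k : ℕ} (hk : k < n) :
    ∑ M ∈ matchingsWithPrefix n (k + 1), (-1 : ℤ) ^ cr M =
      ∑ M ∈ matchingsWithPrefix n k, (-1 : ℤ) ^ cr M := by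
  obtain ⟨a, ha⟩ : ∃ a : Fin (2 * n), a.val = 2 * k := ⟨⟨2 * k, by omega⟩, rfl⟩
  obtain ⟨b, hb⟩ : ∃ b : Fin (2 * n), b.val = 2 * k + 1 := ⟨⟨2 * k + 1, by omega⟩, rfl⟩
  have hab : b.val = a.val + 1 := by omega
  have hsucc : matchingsWithPrefix n (k + 1) =
      (matchingsWithPrefix n k).filter (fun M => (a, b) ∈ M) := by
    ext M
    simp only [Finset.mem_filter, mem_matchingsWithPrefix, and_assoc, Nat.lt_succ_iff_lt_or_eq]
    refine and_congr_right fun _ => ⟨fun h => ⟨fun j hj => h j (.inl hj), ?_⟩, ?_⟩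
    · exact h k (.inr rfl) (a, b) ha hb
    · rintro ⟨h, hmem⟩ j (hj | rfl) p h1 h2
      · exact h j hj p h1 h2
      · rwa [show p = (a, b) by ext <;> simp [h1, h2, ha, hb]]
  rw [hsucc, ← Finset.sum_filter_add_sum_filter_not (matchingsWithPrefix n k)
    (fun M => (a, b) ∈ M), left_eq_add]
  refine Finset.sum_involution (fun M _ => relabel (Equiv.swap a b) M) ?_ ?_ ?_ ?_
  · intro M hM
    rw [Finset.mem_filter, mem_matchingsWithPrefix] at hM
    exact neg_one_pow_cr_relabel_swap hM.1.1 hab hM.2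
  · intro M hM _ heq
    rw [Finset.mem_filter, mem_matchingsWithPrefix] at hM
    have := neg_one_pow_cr_relabel_swap hM.1.1 hab hM.2
    rw [heq] at this
    rcases neg_one_pow_eq_or ℤ (cr M) with h | h <;> rw [h] at this <;> norm_num at this
  · intro M hM
    rw [Finset.mem_filter, mem_matchingsWithPrefix] at hM ⊢
    obtain ⟨⟨hPM, hpre⟩, hmem⟩ := hM
    refine ⟨⟨hPM.relabel_swap hab hmem, fun j hj p h1 h2 => ?_⟩, fun hmem' => ?_⟩
    · rw [mem_relabel_swap, Equiv.swap_apply_of_ne_of_ne, Equiv.swap_apply_of_ne_of_ne]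
      · exact hpre j hj p h1 h2
      all_goals rw [ne_eq, Fin.ext_iff]; omega
    · rw [mem_relabel_swap, Equiv.swap_apply_left, Equiv.swap_apply_right] at hmem'
      have := hPM.1 _ hmem'
      simp only [Fin.lt_def] at this
      omega
  · intro M _
    exact relabel_swap_relabel_swap a b M

lemma mem_iff_of_mem_matchingsWithPrefix {n : ℕ} {M : Finset (Fin (2 * n) × Fin (2 * n))}
    (hM : M ∈ matchingsWithPrefix n n) (p : Fin (2 * n) × Fin (2 * n)) :
    p ∈ M ↔ p.1.val % 2 = 0 ∧ p.2.val = p.1.val + 1 := by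
  rw [mem_matchingsWithPrefix] at hM
  obtain ⟨hPM, hpre⟩ := hM
  refine ⟨fun hp => ?_, fun hp => hpre (p.1.val / 2) (by omega) p (by omega) (by omega)⟩
  have hlt := hPM.1 p hp
  obtain ⟨a, ha⟩ : ∃ a : Fin (2 * n), a.val = 2 * (p.1.val / 2) :=
    ⟨⟨2 * (p.1.val / 2), by omega⟩, rfl⟩
  obtain ⟨b, hb⟩ : ∃ b : Fin (2 * n), b.val = 2 * (p.1.val / 2) + 1 :=
    ⟨⟨2 * (p.1.val / 2) + 1, by omega⟩, rfl⟩
  have hmem := hpre (p.1.val / 2) (by omega) (a, b) ha hb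
  have hv : a = p.1 ∨ b = p.1 := by
    simp only [Fin.ext_iff]
    omega
  obtain rfl := hPM.eq_of_mem hp hmem p.1 (.inl rfl) hv
  dsimp only at ha hb ⊢
  omega

lemma sum_matchingsWithPrefix_self (n : ℕ) :
    ∑ M ∈ matchingsWithPrefix n n, (-1 : ℤ) ^ cr M = 1 := by
  set M₀ : Finset (Fin (2 * n) × Fin (2 * n)) :=
    Finset.univ.filter fun p => p.1.val % 2 = 0 ∧ p.2.val = p.1.val + 1 with hM₀
  have hmem₀ : ∀ p, p ∈ M₀ ↔ p.1.val % 2 = 0 ∧ p.2.val = p.1.val + 1 := by simp [hM₀]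
  have hPM : IsPerfectMatching' M₀ := by
    refine ⟨fun p hp => ?_, fun v => ?_⟩
    · have := (hmem₀ p).1 hp
      rw [Fin.lt_def]
      omega
    · rw [Finset.card_eq_one]
      refine ⟨(⟨2 * (v.val / 2), by omega⟩, ⟨2 * (v.val / 2) + 1, by omega⟩), ?_⟩
      ext ⟨x, y⟩
      simp only [Finset.mem_filter, hmem₀, Finset.mem_singleton, Prod.mk.injEq, Fin.ext_iff]
      omega
  have hsingle : matchingsWithPrefix n n = {M₀} := by
    ext M
    rw [Finset.mem_singleton]
    constructor
    · intro hM
      ext p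
      rw [hmem₀, mem_iff_of_mem_matchingsWithPrefix hM]
    · rintro rfl
      refine mem_matchingsWithPrefix.2 ⟨hPM, fun j _ p h1 h2 => (hmem₀ p).2 ?_⟩
      omega
  have hcr : cr M₀ = 0 := by
    rw [cr_eq_card_filter, Finset.card_eq_zero, Finset.filter_eq_empty_iff]
    rintro ⟨p, q⟩ hz
    rw [Finset.mem_product, hmem₀, hmem₀] at hz
    simp only [Fin.lt_def] at hz ⊢
    omega
  rw [hsingle, Finset.sum_singleton, hcr, pow_zero]

/-- For every `n ≥ 1`, the sum over all perfect matchings `M` of `{1,…,2n}` of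
`(−1)^{cr(M)}` equals `1`. -/
theorem sum_neg_one_pow_cr_eq_one (n : ℕ) (hn : 1 ≤ n) :
    ∑ M ∈ Finset.univ.filter
        (fun M : Finset (Fin (2 * n) × Fin (2 * n)) => IsPerfectMatching' M),
      (-1 : ℤ) ^ cr M = 1 := by
  have hconst : ∀ k ≤ n, ∑ M ∈ matchingsWithPrefix n k, (-1 : ℤ) ^ cr M =
      ∑ M ∈ matchingsWithPrefix n 0, (-1 : ℤ) ^ cr M := by
    intro k hk
    induction k with
    | zero => rfl
    | succ k ih => rw [sum_matchingsWithPrefix_succ hk, ih (by omega)]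
  have hzero := hconst n le_rfl
  rw [sum_matchingsWithPrefix_self] at hzero
  simpa [matchingsWithPrefix] using hzero.symm
end

section
/- Let n ≥ 1 and let M be a perfect matching of {1,…,2n} in which 1 and 2 are not matched to each other. Let M′ be the perfect matching obtained from M by exchanging the roles of the two elements 1 and 2 (i.e., relabelling M via the transposition (1 2)). Then cr(M′) and cr(M) have opposite parities: (−1)^{cr(M′)} = −(−1)^{cr(M)}. -/
/-- The first vertex. -/
def v0 (n : ℕ) (hn : 1 ≤ n) : Fin (2 * n) := ⟨0, by omega⟩

/-- The second vertex. -/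
def v1 (n : ℕ) (hn : 1 ≤ n) : Fin (2 * n) := ⟨1, by omega⟩

/-- In a perfect matching every vertex lies in exactly one chord. -/
theorem IsPerfectMatching'.existsUnique_mem {n : ℕ} {M : Finset (Fin (2 * n) × Fin (2 * n))}
    (hM : IsPerfectMatching' M) (v : Fin (2 * n)) :
    ∃ p ∈ M, (p.1 = v ∨ p.2 = v) ∧ ∀ q ∈ M, (q.1 = v ∨ q.2 = v) → q = p := by
  obtain ⟨p, hp⟩ := Finset.card_eq_one.mp (hM.2 v)
  have hmem : ∀ q, (q ∈ M ∧ (q.1 = v ∨ q.2 = v)) ↔ q = p := fun q => by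
    simpa only [Finset.mem_filter, Finset.mem_singleton] using Finset.ext_iff.mp hp q
  exact ⟨p, ((hmem p).2 rfl).1, ((hmem p).2 rfl).2, fun q hq hv => (hmem q).1 ⟨hq, hv⟩⟩

/-- Relabelling by an injective map and counting crossings is counting crossings of the
relabelled pairs. -/
theorem cr_image_of_injective {n : ℕ} (M : Finset (Fin (2 * n) × Fin (2 * n)))
    {f : Fin (2 * n) × Fin (2 * n) → Fin (2 * n) × Fin (2 * n)} (hf : Function.Injective f) :
    cr (M.image f) =
      ((M ×ˢ M).filter
        (fun z => (f z.1).1 < (f z.2).1 ∧ chordCross (f z.1) (f z.2))).card := by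
  unfold cr
  rw [← Finset.prodMap_image_product, Finset.filter_image,
    Finset.card_image_of_injective _ (hf.prodMap hf)]
  rfl

theorem lt_and_chordCross_iff {n : ℕ} (p q : Fin (2 * n) × Fin (2 * n)) :
    p.1 < q.1 ∧ chordCross p q ↔ p.1 < q.1 ∧ q.1 < p.2 ∧ p.2 < q.2 := by
  unfold chordCross
  constructor
  · rintro ⟨h, h' | h'⟩
    · exact h'
    · exact absurd h h'.1.not_gt
  · exact fun h => ⟨h.1, Or.inl h⟩

/-- Two finite sets that agree after erasing `a` from one and `b` from the other, where exactly
one of these elements is present, have cardinalities of opposite parity. -/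
theorem neg_one_pow_card_eq_neg_of_erase_eq {α : Type*} [DecidableEq α] {s t : Finset α} {a b : α}
    (h : s.erase a = t.erase b) (hab : a ∈ s ↔ b ∉ t) :
    (-1 : ℤ) ^ s.card = -(-1 : ℤ) ^ t.card := by
  by_cases ha : a ∈ s
  · rw [← Finset.card_erase_add_one ha, h, Finset.erase_eq_of_notMem (hab.1 ha), pow_succ]
    ring
  · have hb : b ∈ t := by tauto
    rw [← Finset.card_erase_add_one hb, ← h, Finset.erase_eq_of_notMem ha, pow_succ]
    ring

/-- If `M` is a perfect matching of `{1,…,2n}` in which the first two vertices are not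
matched to each other, and `M′` is obtained from `M` by relabelling via the transposition
exchanging these two vertices (re-sorting each pair increasingly), then
`(−1)^{cr(M′)} = −(−1)^{cr(M)}`. -/
theorem neg_one_pow_cr_swap (n : ℕ) (hn : 1 ≤ n)
    (M : Finset (Fin (2 * n) × Fin (2 * n)))
    (hM : IsPerfectMatching' M)
    (h12 : (v0 n hn, v1 n hn) ∉ M) :
    (-1 : ℤ) ^ cr (M.image (fun p =>
        if Equiv.swap (v0 n hn) (v1 n hn) p.1 < Equiv.swap (v0 n hn) (v1 n hn) p.2
        then (Equiv.swap (v0 n hn) (v1 n hn) p.1, Equiv.swap (v0 n hn) (v1 n hn) p.2)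
        else (Equiv.swap (v0 n hn) (v1 n hn) p.2, Equiv.swap (v0 n hn) (v1 n hn) p.1)))
      = -(-1 : ℤ) ^ cr M := by
  obtain ⟨p, hp, hpv, hpu⟩ := hM.existsUnique_mem (v0 n hn)
  obtain ⟨q, hq, hqv, hqu⟩ := hM.existsUnique_mem (v1 n hn)
  have hv0 : (v0 n hn).val = 0 := rfl
  have hv1 : (v1 n hn).val = 1 := rfl
  have hlt : ∀ r ∈ M, r.1.val < r.2.val := fun r hr => hM.1 r hr
  have hsnd : ∀ r ∈ M, 2 ≤ r.2.val := by
    intro r hr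
    by_contra hlt2
    have hr12 := hlt r hr
    refine h12 ?_
    have : r = (v0 n hn, v1 n hn) :=
      Prod.ext (Fin.ext (by simp only [hv0]; omega)) (Fin.ext (by simp only [hv1]; omega))
    rwa [← this]
  have hp1 : p.1 = v0 n hn := hpv.resolve_right fun h => by
    have := hsnd p hp; rw [h] at this; omega
  have hq1 : q.1 = v1 n hn := hqv.resolve_right fun h => by
    have := hsnd q hq; rw [h] at this; omega
  have hne : p.2 ≠ q.2 := by
    intro h
    obtain ⟨r, -, -, hr⟩ := hM.existsUnique_mem p.2
    have hpq : p = q := (hr p hp (Or.inr rfl)).trans (hr q hq (Or.inr h.symm)).symm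
    rw [hpq, hq1] at hp1
    exact absurd (congrArg Fin.val hp1) (by omega)
  set σ := Equiv.swap (v0 n hn) (v1 n hn) with hσ
  have hσ2 : ∀ r ∈ M, σ r.2 = r.2 := fun r hr => by
    have := hsnd r hr
    exact Equiv.swap_apply_of_ne_of_ne (fun h => by rw [h] at this; omega)
      (fun h => by rw [h] at this; omega)
  have hσval : ∀ x, (x.val = 0 ∧ (σ x).val = 1) ∨ (x.val = 1 ∧ (σ x).val = 0) ∨
      (2 ≤ x.val ∧ (σ x).val = x.val) := by
    intro x
    rw [hσ, Equiv.swap_apply_def]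
    split_ifs with h0 h1
    · subst h0; exact Or.inl ⟨hv0, hv1⟩
    · subst h1; exact Or.inr (Or.inl ⟨hv1, hv0⟩)
    · rw [Fin.ext_iff] at h0 h1
      exact Or.inr (Or.inr ⟨by omega, rfl⟩)
  have himage : M.image (fun p => if σ p.1 < σ p.2 then (σ p.1, σ p.2) else (σ p.2, σ p.1)) =
      M.image (Prod.map σ σ) := by
    refine Finset.image_congr fun r hr => if_pos ?_
    have h2 := hsnd r hr
    have h12 := hlt r hr
    rw [hσ2 r hr, Fin.lt_def]
    have := hσval r.1
    omega
  rw [himage, cr_image_of_injective M (σ.injective.prodMap σ.injective)]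
  unfold cr
  simp only [lt_and_chordCross_iff]
  refine neg_one_pow_card_eq_neg_of_erase_eq (a := (q, p)) (b := (p, q)) ?_ ?_
  · ext ⟨r, t⟩
    simp only [Finset.mem_erase, Finset.mem_filter, Finset.mem_product, Prod.map_fst, Prod.map_snd,
      ne_eq, Prod.mk.injEq]
    by_cases hrt : r ∈ M ∧ t ∈ M
    swap
    · tauto
    obtain ⟨hr, ht⟩ := hrt
    have hfst0 : ∀ u ∈ M, u = p ↔ u.1.val = 0 := fun u hu =>
      ⟨fun h => by rw [h, hp1, hv0], fun h => hpu u hu (Or.inl (Fin.ext h))⟩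
    have hfst1 : ∀ u ∈ M, u = q ↔ u.1.val = 1 := fun u hu =>
      ⟨fun h => by rw [h, hq1, hv1], fun h => hqu u hu (Or.inl (Fin.ext h))⟩
    rw [hfst0 r hr, hfst0 t ht, hfst1 r hr, hfst1 t ht, hσ2 r hr, hσ2 t ht]
    simp only [Fin.lt_def, hr, ht, true_and]
    have := hσval r.1
    have := hσval t.1
    have := hsnd r hr
    omega
  · simp only [Finset.mem_filter, Finset.mem_product, Prod.map_fst, Prod.map_snd, hp, hq, true_and,
      hσ2 p hp, hσ2 q hq, Fin.lt_def]
    have := hσval p.1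
    have := hσval q.1
    have := hsnd p hp
    have := hsnd q hq
    rw [Ne, Fin.ext_iff] at hne
    rw [Fin.ext_iff] at hp1 hq1
    omega
end

section
/- Let H be a finite-dimensional vector space over 𝔽₂ equipped with a nondegenerate alternating bilinear form B. Then for every x ∈ H, the sum over all quadratic forms q on (H,B) of S(q)·(−1)^{q(x)} equals |H| (the cardinality of H). -/
theorem neg_one_pow_val_add (a b : ZMod 2) :
    (-1 : ℤ) ^ (a + b).val = (-1) ^ a.val * (-1) ^ b.val := by
  revert a b; decide

theorem neg_one_pow_val_mul_self (a : ZMod 2) :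
    (-1 : ℤ) ^ a.val * (-1) ^ a.val = 1 := by
  revert a; decide

section QuadraticRefinement

variable {H : Type*} [AddCommGroup H] [Module (ZMod 2) H]

/-- Over `𝔽₂`, every alternating bilinear form admits a quadratic refinement. -/
theorem exists_quadratic_refinement [Module.Finite (ZMod 2) H]
    (B : H →ₗ[ZMod 2] H →ₗ[ZMod 2] ZMod 2) (halt : ∀ x, B x x = 0) :
    ∃ q : H → ZMod 2, ∀ a b, q (a + b) = q a + q b + B a b := by
  let b := Module.finBasis (ZMod 2) H
  let A : H →ₗ[ZMod 2] H →ₗ[ZMod 2] ZMod 2 :=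
    b.constr (ZMod 2) fun i => b.constr (ZMod 2) fun j => if i < j then B (b i) (b j) else 0
  have hA : A + A.flip = B := by
    refine b.ext fun i => b.ext fun j => ?_
    have hA' (i j) : A (b i) (b j) = if i < j then B (b i) (b j) else 0 := by
      simp only [A, Module.Basis.constr_basis]
    rw [LinearMap.add_apply, LinearMap.add_apply, LinearMap.flip_apply, hA', hA']
    rcases lt_trichotomy i j with h | rfl | h
    · simp [h, h.not_gt]
    · simp [halt]
    · have hB : B.IsAlt := halt
      simp [h, h.not_gt, ← hB.neg (b i) (b j), ZMod.neg_eq_self_mod_two]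
  refine ⟨fun x => A x x, fun x y => ?_⟩
  rw [← hA]
  simp only [map_add, LinearMap.add_apply, LinearMap.flip_apply]
  ring

/-- The quadratic refinements of a nondegenerate alternating form on `H` form a torsor
under `H`, hence there are `|H|` of them. -/
theorem card_quadratic_refinements [Fintype H] [DecidableEq H]
    (B : H →ₗ[ZMod 2] H →ₗ[ZMod 2] ZMod 2) (halt : ∀ x, B x x = 0)
    (hnd : ∀ x, (∀ y, B x y = 0) → x = 0) :
    (Finset.univ.filter
      fun q : H → ZMod 2 => ∀ a b, q (a + b) = q a + q b + B a b).card = Fintype.card H := by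
  obtain ⟨q₀, hq₀⟩ := exists_quadratic_refinement B halt
  have hinj : Function.Injective B :=
    (injective_iff_map_eq_zero B).2 fun v hv => hnd v fun y => by simp [hv]
  have hsurj : Function.Surjective B :=
    (LinearMap.injective_iff_surjective_of_finrank_eq_finrank
      (Subspace.dual_finrank_eq (K := ZMod 2) (V := H)).symm).1 hinj
  rw [← Finset.card_univ]
  symm
  refine Finset.card_bij (fun v _ => fun x => q₀ x + B v x) ?_ ?_ ?_
  · intro v _
    simp only [Finset.mem_filter, Finset.mem_univ, true_and]
    intro a b
    rw [hq₀, map_add]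
    ring
  · intro v _ w _ h
    exact hinj (LinearMap.ext fun x => add_left_cancel (congrFun h x))
  · intro q hq
    simp only [Finset.mem_filter, Finset.mem_univ, true_and] at hq
    let d : H →+ ZMod 2 := AddMonoidHom.mk' (fun x => q x - q₀ x) fun a b => by
      rw [hq, hq₀]
      ring
    obtain ⟨v, hv⟩ := hsurj (d.toZModLinearMap 2)
    refine ⟨v, Finset.mem_univ _, funext fun x => ?_⟩
    have hx : B v x = q x - q₀ x := by rw [hv]; rfl
    rw [hx]
    ring

/-- For distinct points, the signs of the quadratic refinements cancel. -/
theorem sum_quadratic_refinements_eq_zero [Fintype H] [DecidableEq H]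
    (B : H →ₗ[ZMod 2] H →ₗ[ZMod 2] ZMod 2) (halt : ∀ x, B x x = 0)
    (hnd : ∀ x, (∀ y, B x y = 0) → x = 0) {x y : H} (hxy : y ≠ x) :
    ∑ q ∈ Finset.univ.filter
        (fun q : H → ZMod 2 => ∀ a b, q (a + b) = q a + q b + B a b),
      (-1 : ℤ) ^ (q y).val * (-1 : ℤ) ^ (q x).val = 0 := by
  have hB : B.IsAlt := halt
  obtain ⟨v, hv⟩ : ∃ v, B v (y - x) ≠ 0 := by
    by_contra! h
    exact hxy (sub_eq_zero.1 (hnd _ fun v => by rw [← hB.neg, h, neg_zero]))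
  have hsign : (-1 : ℤ) ^ (B v y).val * (-1) ^ (B v x).val = -1 := by
    rw [map_sub] at hv
    generalize B v y = s at hv ⊢
    generalize B v x = t at hv ⊢
    revert s t
    decide
  refine Finset.sum_involution (fun q _ => fun z => q z + B v z) ?_ ?_ ?_ ?_
  · intro q _
    rw [neg_one_pow_val_add, neg_one_pow_val_add]
    linear_combination (-1 : ℤ) ^ (q y).val * (-1) ^ (q x).val * hsign
  · intro q _ _ h
    have h0 (z) : B v z = 0 := by simpa using congrFun h z
    exact hv (h0 _)
  · intro q hq
    simp only [Finset.mem_filter, Finset.mem_univ, true_and] at hq ⊢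
    intro a b
    rw [hq, map_add]
    ring
  · intro q _
    funext z
    rw [add_assoc, CharTwo.add_self_eq_zero, add_zero]

end QuadraticRefinement

/-- Let `H` be a finite-dimensional vector space over `𝔽₂` with a nondegenerate
alternating bilinear form `B`.  Then for every `x ∈ H`, the sum over all quadratic forms
`q` on `(H,B)` of `S(q)·(−1)^{q(x)}` equals `|H|`, where `S(q) = Σ_y (−1)^{q(y)}` is the
Gauss sum of `q`. -/
theorem sum_gauss_mul_neg_one_pow_eq_card
    (H : Type) [AddCommGroup H] [Module (ZMod 2) H] [Fintype H] [DecidableEq H]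
    (B : H →ₗ[ZMod 2] H →ₗ[ZMod 2] ZMod 2)
    (halt : ∀ x, B x x = 0)
    (hnd : ∀ x, (∀ y, B x y = 0) → x = 0)
    (x : H) :
    ∑ q ∈ Finset.univ.filter
        (fun q : H → ZMod 2 => ∀ a b, q (a + b) = q a + q b + B a b),
      (∑ y, (-1 : ℤ) ^ (q y).val) * (-1 : ℤ) ^ (q x).val = Fintype.card H := by
  simp_rw [Finset.sum_mul]
  rw [Finset.sum_comm, Finset.sum_eq_single x]
  · simp_rw [neg_one_pow_val_mul_self]
    rw [Finset.sum_const, card_quadratic_refinements B halt hnd, nsmul_one]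
  · intro y _ hyx
    exact sum_quadratic_refinements_eq_zero B halt hnd hyx
  · simp
end

section
/- Let H be a finite-dimensional vector space over 𝔽₂ with a symmetric bilinear form B, let q₁ and q₂ be quadratic enhancements on (H,B), and let Δ ∈ H satisfy q₂(x) = q₁(x) + 2·B(Δ,x) for all x ∈ H. Then 2·q₁(Δ) = 2·q₂(Δ) in ℤ/4, and the complex Gauss sums satisfy T(q₁) = i^{q₁(Δ)}·T(q₂). -/
theorem Complex.I_pow_zmod_val_add (a b : ZMod 4) :
    Complex.I ^ (a + b).val = Complex.I ^ a.val * Complex.I ^ b.val := by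
  rw [ZMod.val_add, ← pow_add, ← Complex.I_pow_eq_pow_mod]

/-- Let `H` be a finite-dimensional vector space over `𝔽₂` with a symmetric bilinear form
`B`, let `q₁, q₂` be quadratic enhancements on `(H,B)`, and let `Δ ∈ H` satisfy
`q₂(x) = q₁(x) + 2·B(Δ,x)` for all `x`.  Then `2·q₁(Δ) = 2·q₂(Δ)` in `ℤ/4`, and the
complex Gauss sums `T(q) = Σ_y i^{q(y)}` satisfy `T(q₁) = i^{q₁(Δ)}·T(q₂)`. -/
theorem gauss_sum_enhancement_diff
    (H : Type) [AddCommGroup H] [Module (ZMod 2) H] [Fintype H]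
    (B : H →ₗ[ZMod 2] H →ₗ[ZMod 2] ZMod 2)
    (hsymm : ∀ x y, B x y = B y x)
    (q₁ q₂ : H → ZMod 4)
    (hq₁par : ∀ a, ZMod.castHom (show (2 : ℕ) ∣ 4 by norm_num) (ZMod 2) (q₁ a) = B a a)
    (hq₁ : ∀ a b, q₁ (a + b) = q₁ a + q₁ b + 2 * ((B a b).val : ZMod 4))
    (hq₂par : ∀ a, ZMod.castHom (show (2 : ℕ) ∣ 4 by norm_num) (ZMod 2) (q₂ a) = B a a)
    (hq₂ : ∀ a b, q₂ (a + b) = q₂ a + q₂ b + 2 * ((B a b).val : ZMod 4))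
    (Δ : H)
    (hΔ : ∀ x, q₂ x = q₁ x + 2 * ((B Δ x).val : ZMod 4)) :
    2 * q₁ Δ = 2 * q₂ Δ ∧
      (∑ y, Complex.I ^ (q₁ y).val)
        = Complex.I ^ (q₁ Δ).val * ∑ y, Complex.I ^ (q₂ y).val := by
  have hfour : (2 : ZMod 4) * 2 = 0 := rfl
  refine ⟨by rw [hΔ Δ, mul_add, ← mul_assoc, hfour, zero_mul, add_zero], ?_⟩
  have hshift : ∀ y, q₁ (y + Δ) = q₁ Δ + q₂ y := fun y => by
    rw [hq₁, hΔ, hsymm y Δ]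
    ring
  rw [Finset.mul_sum, ← Equiv.sum_comp (Equiv.addRight Δ)]
  refine Finset.sum_congr rfl fun y _ => ?_
  rw [Equiv.coe_addRight, hshift, Complex.I_pow_zmod_val_add]
end

section
/- Let G be a finite simple graph and let M be a perfect matching of the terminal graph G^T. Then the set of edges of G that are not long-matched by M is an even subset of the edges of G, i.e., every vertex of G is incident to an even number of such edges. -/
/-- The terminal graph `G^T` of a simple graph `G`: its vertices are the darts of `G`,
two distinct darts being adjacent iff they have the same initial vertex ('short' edge)
or each is the reversal of the other ('long' edge). -/
def terminalGraph {V : Type} (G : SimpleGraph V) : SimpleGraph G.Dart :=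
  SimpleGraph.fromRel (fun d d' => d.toProd.1 = d'.toProd.1 ∨ d' = d.symm)

/-- A matching restricts to a matching on any set of matched vertices that is closed under
passing to partners. -/
theorem SimpleGraph.Subgraph.IsMatching.induce_of_closed {W : Type*} {H : SimpleGraph W}
    {M : H.Subgraph} (hM : M.IsMatching) {s : Set W} (hs : s ⊆ M.verts)
    (hclosed : ∀ ⦃a b⦄, a ∈ s → M.Adj a b → b ∈ s) : (M.induce s).IsMatching := by
  intro a ha
  obtain ⟨b, hab, hb⟩ := hM (hs ha)
  exact ⟨b, ⟨ha, hclosed ha hab, hab⟩, fun c hc => hb c hc.2.2⟩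

/-- Adjacent vertices of the terminal graph share their initial vertex or are reversals of
each other. -/
theorem fst_eq_or_eq_symm_of_terminalGraph_adj {V : Type} {G : SimpleGraph V} {d e : G.Dart}
    (h : (terminalGraph G).Adj d e) : e.toProd.1 = d.toProd.1 ∨ e = d.symm := by
  obtain ⟨-, (h | h) | (h | h)⟩ := (SimpleGraph.fromRel_adj _ _ _).1 h
  · exact Or.inl h.symm
  · exact Or.inr h
  · exact Or.inl h
  · exact Or.inr (by rw [h, SimpleGraph.Dart.symm_symm])

/-- Let `M` be a perfect matching of the terminal graph `G^T` of a finite simple graph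
`G`.  Then the set of edges of `G` that are not long-matched by `M` is an even subset of
the edges of `G`: every vertex `v` of `G` is incident to an even number of such edges
(counted here by the darts with initial vertex `v` whose edge is not long-matched). -/
theorem even_not_long_matched
    (V : Type) [Fintype V] [DecidableEq V]
    (G : SimpleGraph V) [DecidableRel G.Adj]
    (M : (terminalGraph G).Subgraph) (hM : M.IsPerfectMatching) (v : V) :
    Even (Nat.card {d : G.Dart // d.toProd.1 = v ∧ ¬ M.Adj d d.symm}) := by
  classical
  let s : Set G.Dart := {d | d.toProd.1 = v ∧ ¬ M.Adj d d.symm}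
  have hmatch : (M.induce s).IsMatching := by
    refine hM.1.induce_of_closed (fun d _ => hM.2 d) ?_
    rintro d e ⟨hd, hlong⟩ hde
    rcases fst_eq_or_eq_symm_of_terminalGraph_adj hde.adj_sub with h | rfl
    · refine ⟨h.trans hd, fun he => hlong ?_⟩
      obtain rfl := hM.1.eq_of_adj_left he hde.symm
      rwa [SimpleGraph.Dart.symm_symm, SimpleGraph.Subgraph.adj_comm]
    · exact absurd hde hlong
  have : Fintype (M.induce s).verts := Fintype.ofFinite _
  have heven := hmatch.even_card
  rwa [Set.toFinset_card, ← Nat.card_eq_fintype_card] at heven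
end

section
/- Let G be a finite simple graph and let P be an even subset of the edges of G. Then the number of perfect matchings M of the terminal graph G^T whose set of non-long-matched edges is exactly P equals the product over all vertices v of G of the number of perfect matchings of the complete graph on deg_P(v) vertices, where deg_P(v) is the number of edges of P incident to v. -/
namespace SimpleGraph

/-- The fixed-point-free involutions of the vertex set along edges of `H`. -/
abbrev AdjInvolution {α : Type*} (H : SimpleGraph α) : Type _ :=
  {f : α → α // Function.Involutive f ∧ ∀ x, H.Adj x (f x)}

/-- A perfect matching is the same as the involution exchanging matched vertices. -/
noncomputable def perfectMatchingEquiv {α : Type*} (H : SimpleGraph α) :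
    {M : H.Subgraph // M.IsPerfectMatching} ≃ H.AdjInvolution where
  toFun M :=
    have h := Subgraph.isPerfectMatching_iff.1 M.2
    ⟨fun x => (h x).choose,
      fun x => ((h (h x).choose).choose_spec.2 x (h x).choose_spec.1.symm).symm,
      fun x => (h x).choose_spec.1.adj_sub⟩
  invFun f :=
    ⟨{ verts := Set.univ
       Adj := fun x y => f.1 x = y
       adj_sub := fun {x y} h => h ▸ f.2.2 x
       edge_vert := fun _ => Set.mem_univ _
       symm := ⟨fun x _ h => (congrArg f.1 h).symm.trans (f.2.1 x)⟩ },
      Subgraph.isPerfectMatching_iff.2 fun x => ⟨f.1 x, rfl, fun _ h => Eq.symm h⟩⟩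
  left_inv M := by
    have h := Subgraph.isPerfectMatching_iff.1 M.2
    apply Subtype.ext
    apply Subgraph.ext
    · exact (Set.eq_univ_of_forall M.2.2).symm
    · funext x y
      apply propext
      change (h x).choose = y ↔ _
      exact ⟨fun e => e ▸ (h x).choose_spec.1, fun e => ((h x).choose_spec.2 y e).symm⟩
  right_inv f := by
    apply Subtype.ext
    funext x
    exact (Exists.choose_spec (p := fun y => f.1 x = y ∧ ∀ z, f.1 x = z → z = y) _).1.symm

lemma perfectMatchingEquiv_apply_eq_iff {α : Type*} (H : SimpleGraph α)
    (M : {M : H.Subgraph // M.IsPerfectMatching}) (x y : α) :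
    (perfectMatchingEquiv H M).1 x = y ↔ M.1.Adj x y := by
  have h := Subgraph.isPerfectMatching_iff.1 M.2
  change (h x).choose = y ↔ _
  exact ⟨fun e => e ▸ (h x).choose_spec.1, fun e => ((h x).choose_spec.2 y e).symm⟩

/-- A graph isomorphism transports involutions along edges. -/
def AdjInvolution.congr {α β : Type*} {H : SimpleGraph α} {K : SimpleGraph β} (e : H ≃g K) :
    H.AdjInvolution ≃ K.AdjInvolution where
  toFun f := ⟨fun y => e (f.1 (e.symm y)), fun y => by simp [f.2.1 _],
    fun y => by simpa using e.map_adj_iff.2 (f.2.2 (e.symm y))⟩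
  invFun f := ⟨fun y => e.symm (f.1 (e y)), fun y => by simp [f.2.1 _],
    fun y => by simpa using e.symm.map_adj_iff.2 (f.2.2 (e y))⟩
  left_inv f := by ext; simp
  right_inv f := by ext; simp

end SimpleGraph

open SimpleGraph

lemma terminalGraph_adj {V : Type} {G : SimpleGraph V} {d d' : G.Dart} :
    (terminalGraph G).Adj d d' ↔ d ≠ d' ∧ (d.fst = d'.fst ∨ d' = d.symm) := by
  have : d = d'.symm ↔ d' = d.symm :=
    ⟨fun h => by rw [h, Dart.symm_symm], fun h => by rw [h, Dart.symm_symm]⟩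
  simp only [terminalGraph, fromRel_adj, this, eq_comm (a := d'.toProd.1), or_self]

/-- The darts starting at `v` whose underlying edge lies in `P`. -/
abbrev DartsAt {V : Type} (G : SimpleGraph V) (P : Finset (Sym2 V)) (v : V) : Type :=
  {d : G.Dart // d.fst = v ∧ d.edge ∈ P}

lemma card_dartsAt {V : Type} [DecidableEq V] {G : SimpleGraph V} {P : Finset (Sym2 V)}
    (hP : ∀ e ∈ P, e ∈ G.edgeSet) (v : V) :
    Nat.card (DartsAt G P v) = (P.filter (fun e => v ∈ e)).card := by
  rw [← Nat.card_eq_finsetCard]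
  refine Nat.card_congr (Equiv.ofBijective
    (fun d => ⟨d.1.edge, Finset.mem_filter.2 ⟨d.2.2, ?_⟩⟩) ⟨?_, ?_⟩)
  · have h : d.1.fst ∈ d.1.edge := Sym2.mem_mk_left d.1.fst d.1.snd
    rwa [d.2.1] at h
  · rintro ⟨d, hd, _⟩ ⟨d', hd', _⟩ h
    rcases dart_edge_eq_iff d d' |>.1 (congrArg Subtype.val h) with h | h
    · exact Subtype.ext h
    · subst h
      exact absurd (hd.trans hd'.symm) d'.adj.ne'
  · rintro ⟨e, he⟩
    obtain ⟨heP, w, rfl⟩ := Finset.mem_filter.1 he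
    exact ⟨⟨⟨(v, w), hP _ heP⟩, rfl, heP⟩, rfl⟩

/-- The involutions of the darts whose non-long-matched edges are exactly those of `P` are the
families of fixed-point-free involutions of the sets `DartsAt G P v`. -/
def terminalInvolutionEquiv {V : Type} [DecidableEq V] (G : SimpleGraph V)
    (P : Finset (Sym2 V)) :
    {f : (terminalGraph G).AdjInvolution // ∀ d : G.Dart, (d.edge ∈ P ↔ ¬ f.1 d = d.symm)} ≃
      ∀ v, (⊤ : SimpleGraph (DartsAt G P v)).AdjInvolution where
  toFun f v :=
    have hfst : ∀ d : G.Dart, d.edge ∈ P → d.fst = (f.1.1 d).fst := fun d hd =>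
      (terminalGraph_adj.1 (f.1.2.2 d)).2.resolve_right ((f.2 d).1 hd)
    have hmem : ∀ d : G.Dart, d.edge ∈ P → (f.1.1 d).edge ∈ P := fun d hd => by
      rw [f.2, f.1.2.1 d]
      intro h
      exact (f.2 d).1 hd (by rw [congrArg Dart.symm h, Dart.symm_symm])
    ⟨fun d => ⟨f.1.1 d.1, (hfst d.1 d.2.2).symm.trans d.2.1, hmem d.1 d.2.2⟩,
      fun d => Subtype.ext (f.1.2.1 d.1),
      fun d h => (f.1.2.2 d.1).ne (congrArg Subtype.val h)⟩
  invFun g :=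
    have hin : ∀ (d : G.Dart) (hd : d.edge ∈ P) (v : V) (hv : d.fst = v),
        ((g d.fst).1 ⟨d, rfl, hd⟩).1 = ((g v).1 ⟨d, hv, hd⟩).1 := by
      rintro d hd _ rfl; rfl
    ⟨⟨fun d => if hd : d.edge ∈ P then ((g d.fst).1 ⟨d, rfl, hd⟩).1 else d.symm,
      fun d => by
        by_cases hd : d.edge ∈ P
        · have h := ((g d.fst).1 ⟨d, rfl, hd⟩).2
          dsimp only
          rw [dif_pos hd, dif_pos h.2, hin _ h.2 _ h.1]
          exact congrArg Subtype.val ((g d.fst).2.1 _)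
        · simp [hd],
      fun d => terminalGraph_adj.2 <| by
        by_cases hd : d.edge ∈ P
        · simp only [hd, dite_true]
          exact ⟨fun h => (g d.fst).2.2 ⟨d, rfl, hd⟩ (Subtype.ext h),
            Or.inl ((g d.fst).1 ⟨d, rfl, hd⟩).2.1.symm⟩
        · simp only [hd, dite_false]
          exact ⟨d.symm_ne.symm, Or.inr trivial⟩⟩,
      fun d => by
        by_cases hd : d.edge ∈ P
        · simp only [hd, dite_true, true_iff]
          intro h
          have h' := ((g d.fst).1 ⟨d, rfl, hd⟩).2.1
          rw [h] at h'
          exact d.adj.ne h'.symm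
        · simp [hd]⟩
  left_inv f := by
    apply Subtype.ext
    apply Subtype.ext
    funext d
    by_cases hd : d.edge ∈ P
    · simp [hd]
    · simp only [hd, dite_false]
      exact (not_not.1 (mt (f.2 d).2 hd)).symm
  right_inv g := by
    funext v
    apply Subtype.ext
    funext ⟨d, hv, hd⟩
    subst hv
    apply Subtype.ext
    simp [hd]


/-- Let `G` be a finite simple graph and `P` an even subset of the edges of `G` (every
vertex is incident to an even number of edges of `P`).  Then the number of perfect
matchings `M` of the terminal graph `G^T` whose set of non-long-matched edges is exactly
`P` equals the product over all vertices `v` of the number of perfect matchings of the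
complete graph on `deg_P(v)` vertices. -/
theorem card_matchings_with_fiber_eq_prod
    (V : Type) [Fintype V] [DecidableEq V]
    (G : SimpleGraph V) [DecidableRel G.Adj]
    (P : Finset (Sym2 V)) (hP : ∀ e ∈ P, e ∈ G.edgeSet)
    (hPeven : ∀ v : V, Even ((P.filter (fun e => v ∈ e)).card)) :
    Nat.card {M : (terminalGraph G).Subgraph //
        M.IsPerfectMatching ∧ ∀ d : G.Dart, (d.edge ∈ P ↔ ¬ M.Adj d d.symm)}
      = ∏ v : V,
          Nat.card {M : (⊤ : SimpleGraph (Fin ((P.filter (fun e => v ∈ e)).card))).Subgraph //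
            M.IsPerfectMatching} := by
  classical
  have hM : {M : (terminalGraph G).Subgraph //
        M.IsPerfectMatching ∧ ∀ d : G.Dart, (d.edge ∈ P ↔ ¬ M.Adj d d.symm)} ≃
      {f : (terminalGraph G).AdjInvolution //
        ∀ d : G.Dart, (d.edge ∈ P ↔ ¬ f.1 d = d.symm)} :=
    (Equiv.subtypeSubtypeEquivSubtypeInter _
      (fun M : (terminalGraph G).Subgraph =>
        ∀ d : G.Dart, (d.edge ∈ P ↔ ¬ M.Adj d d.symm))).symm.trans
      ((perfectMatchingEquiv _).subtypeEquiv fun M => by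
        simp only [perfectMatchingEquiv_apply_eq_iff])
  rw [Nat.card_congr (hM.trans (terminalInvolutionEquiv G P)), Nat.card_pi]
  refine Finset.prod_congr rfl fun v _ => ?_
  let e : DartsAt G P v ≃ Fin ((P.filter (fun e => v ∈ e)).card) :=
    Finite.equivFinOfCardEq (card_dartsAt hP v)
  exact Nat.card_congr ((AdjInvolution.congr (Iso.completeGraph e)).trans
    (perfectMatchingEquiv _).symm)
end
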